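/- arXiv:1607.05100 — 4 statements merged into one kernel-verified Lean document; each statement's English description precedes it below -/
import Mathlib

section
/- Let f ∈ L¹(ℝ²,ℍ), let f̃(x₁,x₂) := conj(f(−x₁,−x₂)), and let g := f̃ ∗ f, i.e. g(x₁,x₂) = ∫_{ℝ²} conj(f(y₁,y₂)) f(x₁+y₁, x₂+y₂) dy₁ dy₂ (defined for almost every (x₁,x₂)). Then for every ε > 0, Sc((g ∗ p_ε)(0,0)) = ∫_{ℝ²} P(εω₁, εω₂) |(ℱ_r f)(ω₁,ω₂)|² dω₁ dω₂. -/
open MeasureTheory Real ENNReal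

noncomputable section

/-- The real quaternions. -/
abbrev Hq := Quaternion ℝ

/-- The imaginary unit `i`. -/
def qi : Hq := ⟨0,1,0,0⟩
/-- The imaginary unit `j`. -/
def qj : Hq := ⟨0,0,1,0⟩
/-- The imaginary unit `k`. -/
def qk : Hq := ⟨0,0,0,1⟩

/-- For a (unit pure imaginary) quaternion `u`, `e^{uθ} := cos θ + u sin θ`. -/
def qexp (u : Hq) (θ : ℝ) : Hq := (Real.cos θ) • (1 : Hq) + (Real.sin θ) • u

/-- The right-sided quaternion Fourier transform of `f ∈ L¹(ℝ²,ℍ)`. -/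
def Fr (f : ℝ × ℝ → Hq) (ω : ℝ × ℝ) : Hq :=
  (1 / (2 * Real.pi)) • ∫ x : ℝ × ℝ, f x * qexp qi (-(ω.1 * x.1)) * qexp qj (-(ω.2 * x.2))

/-- The two-sided quaternion Fourier transform of `f ∈ L¹(ℝ²,ℍ)`. -/
def Fs (f : ℝ × ℝ → Hq) (ω : ℝ × ℝ) : Hq :=
  (1 / (2 * Real.pi)) • ∫ x : ℝ × ℝ, qexp qi (-(ω.1 * x.1)) * f x * qexp qj (-(ω.2 * x.2))


/-- The 2D Poisson kernel. -/
def poisson (eps : ℝ) (x : ℝ × ℝ) : ℝ :=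
  (1 / Real.pi ^ 2) * (eps ^ 2 / ((eps ^ 2 + x.1 ^ 2) * (eps ^ 2 + x.2 ^ 2)))

/-- The kernel P, with P (a, b) = exp (-|a| - |b|). -/
def Pker (a b : ℝ) : ℝ := Real.exp (-|a| - |b|)

lemma int_exp_Ioi {a : ℝ} (ha : 0 < a) (t : ℝ) :
    ∫ x in Set.Ioi (0:ℝ), Real.exp (-(a * x)) * Real.cos (x * t) = a / (a ^ 2 + t ^ 2) := by
  have hre : ((-a : ℂ) + t * Complex.I).re < 0 := by simp [ha]
  have h1 := integral_exp_mul_complex_Ioi hre 0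
  have h2 := integrableOn_exp_mul_complex_Ioi hre 0
  have h3 := congrArg Complex.re h1
  have h4 : (∫ x in Set.Ioi (0:ℝ), Complex.exp (((-a : ℂ) + t * Complex.I) * x)).re
    = ∫ x in Set.Ioi (0:ℝ), (Complex.exp (((-a : ℂ) + t * Complex.I) * x)).re :=
    (integral_re h2).symm
  rw [h4] at h3
  have h5 : ∀ x : ℝ, (Complex.exp (((-a : ℂ) + t * Complex.I) * x)).re
      = Real.exp (-(a * x)) * Real.cos (x * t) := by
    intro x
    rw [Complex.exp_re]
    simp [mul_comm]
  simp_rw [h5] at h3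
  rw [h3]
  have : a ^ 2 + t ^ 2 ≠ 0 := by positivity
  simp [Complex.div_re, Complex.normSq_apply]
  field_simp

lemma int_exp_cos {a : ℝ} (ha : 0 < a) (t : ℝ) :
    ∫ x : ℝ, Real.exp (-|a * x|) * Real.cos (x * t) = 2 * a / (a ^ 2 + t ^ 2) := by
  have h := integral_comp_abs (f := fun x : ℝ => Real.exp (-(a * x)) * Real.cos (x * t))
  rw [int_exp_Ioi ha] at h
  rw [mul_div_assoc, ← h]
  congr 1; ext x
  rw [abs_mul, abs_of_pos ha]
  congr 1
  rcases abs_cases x with h | h <;> rw [h.1]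
  rw [neg_mul, Real.cos_neg]

lemma int_exp_abs {a : ℝ} (ha : 0 < a) : Integrable (fun x : ℝ => Real.exp (-|a * x|)) := by
  by_contra h
  have h1 := int_exp_cos ha 0
  simp only [mul_zero, Real.cos_zero, mul_one] at h1
  rw [integral_undef h] at h1
  have : 0 < 2 * a / (a ^ 2 + 0 ^ 2) := by positivity
  linarith

lemma int_exp_sin {a : ℝ} (t : ℝ) :
    ∫ x : ℝ, Real.exp (-|a * x|) * Real.sin (x * t) = 0 := by
  have h := integral_neg_eq_self (fun x : ℝ => Real.exp (-|a * x|) * Real.sin (x * t)) volume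
  simp only [mul_neg, abs_neg, neg_mul, Real.sin_neg, integral_neg] at h
  linarith

lemma qexp_qi (θ : ℝ) : qexp qi θ = (⟨Real.cos θ, Real.sin θ, 0, 0⟩ : Hq) := by
  unfold qexp
  ext
  · rw [Quaternion.re_add, Quaternion.re_smul, Quaternion.re_smul, Quaternion.re_one]; simp [qi]
  · rw [Quaternion.imI_add, Quaternion.imI_smul, Quaternion.imI_smul, Quaternion.imI_one]; simp [qi]
  · rw [Quaternion.imJ_add, Quaternion.imJ_smul, Quaternion.imJ_smul, Quaternion.imJ_one]; simp [qi]
  · rw [Quaternion.imK_add, Quaternion.imK_smul, Quaternion.imK_smul, Quaternion.imK_one]; simp [qi]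

lemma qexp_qj (θ : ℝ) : qexp qj θ = (⟨Real.cos θ, 0, Real.sin θ, 0⟩ : Hq) := by
  unfold qexp
  ext
  · rw [Quaternion.re_add, Quaternion.re_smul, Quaternion.re_smul, Quaternion.re_one]; simp [qj]
  · rw [Quaternion.imI_add, Quaternion.imI_smul, Quaternion.imI_smul, Quaternion.imI_one]; simp [qj]
  · rw [Quaternion.imJ_add, Quaternion.imJ_smul, Quaternion.imJ_smul, Quaternion.imJ_one]; simp [qj]
  · rw [Quaternion.imK_add, Quaternion.imK_smul, Quaternion.imK_smul, Quaternion.imK_one]; simp [qj]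

lemma qexp_qi_re (θ : ℝ) : (qexp qi θ).re = Real.cos θ := by rw [qexp_qi]

lemma qexp_qi_imI (θ : ℝ) : (qexp qi θ).imI = Real.sin θ := by rw [qexp_qi]

lemma qexp_qi_imJ (θ : ℝ) : (qexp qi θ).imJ = 0 := by rw [qexp_qi]

lemma qexp_qi_imK (θ : ℝ) : (qexp qi θ).imK = 0 := by rw [qexp_qi]

lemma qexp_qj_re (θ : ℝ) : (qexp qj θ).re = Real.cos θ := by rw [qexp_qj]

lemma qexp_qj_imI (θ : ℝ) : (qexp qj θ).imI = 0 := by rw [qexp_qj]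

lemma qexp_qj_imJ (θ : ℝ) : (qexp qj θ).imJ = Real.sin θ := by rw [qexp_qj]

lemma qexp_qj_imK (θ : ℝ) : (qexp qj θ).imK = 0 := by rw [qexp_qj]

lemma norm_qexp (u : Hq) (hu : u = qi ∨ u = qj) (θ : ℝ) : ‖qexp u θ‖ = 1 := by
  have h : ‖qexp u θ‖ * ‖qexp u θ‖ = 1 := by
    rw [← Quaternion.normSq_eq_norm_mul_self, Quaternion.normSq_def']
    rcases hu with rfl | rfl <;> simp [qexp_qi, qexp_qj]
  nlinarith [norm_nonneg (qexp u θ)]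

lemma cont_qexp (u : Hq) : Continuous (qexp u) := by
  unfold qexp; fun_prop

/-- the modulated function -/
def hmod (f : ℝ × ℝ → Hq) (ω x : ℝ × ℝ) : Hq :=
  f x * qexp qi (-(ω.1 * x.1)) * qexp qj (-(ω.2 * x.2))

lemma norm_hmod (f : ℝ × ℝ → Hq) (ω x : ℝ × ℝ) : ‖hmod f ω x‖ = ‖f x‖ := by
  simp [hmod, norm_mul, norm_qexp]

lemma integrable_hmod {f : ℝ × ℝ → Hq} (hf : Integrable f) (ω : ℝ × ℝ) :
    Integrable (hmod f ω) := by
  refine hf.mono ?_ (Filter.Eventually.of_forall fun x => (norm_hmod f ω x).le)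
  have h1 := cont_qexp qi
  have h2 := cont_qexp qj
  have h3 : Continuous (fun x : ℝ × ℝ => qexp qi (-(ω.1 * x.1))) := by fun_prop
  have h4 : Continuous (fun x : ℝ × ℝ => qexp qj (-(ω.2 * x.2))) := by fun_prop
  exact (hf.1.mul h3.aestronglyMeasurable).mul h4.aestronglyMeasurable

lemma inner_expand (a b : Hq) (w v x1 x2 y1 y2 : ℝ) :
    inner ℝ (a * qexp qi (-(w * x1)) * qexp qj (-(v * x2)))
      (b * qexp qi (-(w * y1)) * qexp qj (-(v * y2))) =
    (star b * a).re * (Real.cos (w * (x1 - y1)) * Real.cos (v * (x2 - y2)))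
    + (star b * a).imI * (Real.sin (w * (x1 - y1)) * Real.cos (v * (x2 - y2)))
    + (star b * a).imJ * (Real.cos (w * (x1 + y1)) * Real.sin (v * (x2 - y2)))
    - (star b * a).imK * (Real.sin (w * (x1 + y1)) * Real.sin (v * (x2 - y2))) := by
  rw [Quaternion.inner_def]
  simp only [mul_sub, mul_add, Real.cos_sub, Real.sin_sub, Real.cos_add, Real.sin_add]
  simp only [qexp_qi_re, qexp_qi_imI, qexp_qi_imJ, qexp_qi_imK,
    qexp_qj_re, qexp_qj_imI, qexp_qj_imJ, qexp_qj_imK,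
    Quaternion.re_mul, Quaternion.imI_mul, Quaternion.imJ_mul, Quaternion.imK_mul,
    Quaternion.re_star, Quaternion.imI_star, Quaternion.imJ_star, Quaternion.imK_star,
    Real.cos_neg, Real.sin_neg]
  ring

lemma int_omega {eps : ℝ} (heps : 0 < eps) (f : ℝ × ℝ → Hq) (x y : ℝ × ℝ) :
    ∫ ω : ℝ × ℝ, Pker (eps * ω.1) (eps * ω.2) * inner ℝ (hmod f ω x) (hmod f ω y) =
      (2 * Real.pi) ^ 2 * (poisson eps (y.1 - x.1, y.2 - x.2) * (star (f y) * f x).re) := by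
  have key : ∀ ω : ℝ × ℝ, Pker (eps * ω.1) (eps * ω.2) * inner ℝ (hmod f ω x) (hmod f ω y) =
    (star (f y) * f x).re * ((Real.exp (-|eps * ω.1|) * Real.cos (ω.1 * (x.1 - y.1))) *
      (Real.exp (-|eps * ω.2|) * Real.cos (ω.2 * (x.2 - y.2))))
    + (star (f y) * f x).imI * ((Real.exp (-|eps * ω.1|) * Real.sin (ω.1 * (x.1 - y.1))) *
      (Real.exp (-|eps * ω.2|) * Real.cos (ω.2 * (x.2 - y.2))))
    + (star (f y) * f x).imJ * ((Real.exp (-|eps * ω.1|) * Real.cos (ω.1 * (x.1 + y.1))) *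
      (Real.exp (-|eps * ω.2|) * Real.sin (ω.2 * (x.2 - y.2))))
    - (star (f y) * f x).imK * ((Real.exp (-|eps * ω.1|) * Real.sin (ω.1 * (x.1 + y.1))) *
      (Real.exp (-|eps * ω.2|) * Real.sin (ω.2 * (x.2 - y.2)))) := by
    intro ω
    unfold hmod Pker
    rw [inner_expand, sub_eq_add_neg, Real.exp_add]
    ring
  have ic : ∀ t : ℝ, Integrable (fun u : ℝ => Real.exp (-|eps * u|) * Real.cos (u * t)) := by
    intro t
    refine (int_exp_abs heps).mul_bdd (c := 1) (by fun_prop) (Filter.Eventually.of_forall ?_)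
    intro u; exact Real.abs_cos_le_one _
  have is : ∀ t : ℝ, Integrable (fun u : ℝ => Real.exp (-|eps * u|) * Real.sin (u * t)) := by
    intro t
    refine (int_exp_abs heps).mul_bdd (c := 1) (by fun_prop) (Filter.Eventually.of_forall ?_)
    intro u; exact Real.abs_sin_le_one _
  simp_rw [key]
  have i1 := ((ic (x.1 - y.1)).mul_prod (ic (x.2 - y.2))).const_mul (star (f y) * f x).re
  have i2 := ((is (x.1 - y.1)).mul_prod (ic (x.2 - y.2))).const_mul (star (f y) * f x).imI
  have i3 := ((ic (x.1 + y.1)).mul_prod (is (x.2 - y.2))).const_mul (star (f y) * f x).imJ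
  have i4 := ((is (x.1 + y.1)).mul_prod (is (x.2 - y.2))).const_mul (star (f y) * f x).imK
  generalize (star (f y) * f x).re = A at *
  generalize (star (f y) * f x).imI = B at *
  generalize (star (f y) * f x).imJ = C at *
  generalize (star (f y) * f x).imK = D at *
  have i12 := i1.add i2
  simp only [Pi.add_def] at i12
  have i123 := i12.add i3
  simp only [Pi.add_def] at i123
  rw [Measure.volume_eq_prod, integral_sub i123 i4, integral_add i12 i3, integral_add i1 i2]
  simp only [integral_const_mul]
  rw [integral_prod_mul (fun u : ℝ => Real.exp (-|eps * u|) * Real.cos (u * (x.1 - y.1)))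
      (fun u : ℝ => Real.exp (-|eps * u|) * Real.cos (u * (x.2 - y.2))),
    integral_prod_mul (fun u : ℝ => Real.exp (-|eps * u|) * Real.sin (u * (x.1 - y.1)))
      (fun u : ℝ => Real.exp (-|eps * u|) * Real.cos (u * (x.2 - y.2))),
    integral_prod_mul (fun u : ℝ => Real.exp (-|eps * u|) * Real.cos (u * (x.1 + y.1)))
      (fun u : ℝ => Real.exp (-|eps * u|) * Real.sin (u * (x.2 - y.2))),
    integral_prod_mul (fun u : ℝ => Real.exp (-|eps * u|) * Real.sin (u * (x.1 + y.1)))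
      (fun u : ℝ => Real.exp (-|eps * u|) * Real.sin (u * (x.2 - y.2)))]
  simp only [int_exp_cos heps, int_exp_sin, poisson]
  have h1 : eps ^ 2 + (x.1 - y.1) ^ 2 ≠ 0 := by positivity
  have h2 : eps ^ 2 + (x.2 - y.2) ^ 2 ≠ 0 := by positivity
  rw [← neg_sub x.1 y.1, ← neg_sub x.2 y.2, neg_sq, neg_sq]
  field_simp
  ring

lemma norm_sq_int {f : ℝ × ℝ → Hq} (hf : Integrable f) (ω : ℝ × ℝ) :
    ‖∫ x, hmod f ω x‖ ^ 2 =
      ∫ p : (ℝ × ℝ) × (ℝ × ℝ), inner ℝ (hmod f ω p.2) (hmod f ω p.1) := by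
  have hi := integrable_hmod hf ω
  have hp : Integrable (fun p : (ℝ × ℝ) × (ℝ × ℝ) => inner ℝ (hmod f ω p.2) (hmod f ω p.1))
      (volume.prod volume) := by
    refine (hi.norm.mul_prod hi.norm).mono ?_ (Filter.Eventually.of_forall fun p => ?_)
    · exact (hi.1.comp_snd).inner (hi.1.comp_fst)
    · refine (norm_inner_le_norm _ _).trans ?_
      simp [mul_comm]
  rw [Measure.volume_eq_prod (ℝ × ℝ) (ℝ × ℝ), integral_prod _ hp, ← real_inner_self_eq_norm_sq,
    ← integral_inner hi]
  congr 1; ext x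
  rw [real_inner_comm, ← integral_inner hi]
  congr 1; ext y
  rw [real_inner_comm]

lemma int_Pker {eps : ℝ} (heps : 0 < eps) :
    Integrable (fun ω : ℝ × ℝ => Pker (eps * ω.1) (eps * ω.2)) := by
  refine ((int_exp_abs heps).mul_prod (int_exp_abs heps)).congr
    (Filter.Eventually.of_forall fun ω => ?_)
  simp only [Pker, sub_eq_add_neg, Real.exp_add]

lemma rhs_eq {f : ℝ × ℝ → Hq} (hf : Integrable f) {eps : ℝ} (heps : 0 < eps) :
    ∫ ω : ℝ × ℝ, Pker (eps * ω.1) (eps * ω.2) * ‖Fr f ω‖ ^ 2 =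
    ∫ p : (ℝ × ℝ) × (ℝ × ℝ), poisson eps (p.1.1 - p.2.1, p.1.2 - p.2.2) *
      (star (f p.1) * f p.2).re := by
  have hFr : ∀ ω, Pker (eps * ω.1) (eps * ω.2) * ‖Fr f ω‖ ^ 2 = ((2 * Real.pi) ^ 2)⁻¹ *
      ∫ p : (ℝ × ℝ) × (ℝ × ℝ), Pker (eps * ω.1) (eps * ω.2) *
        inner ℝ (hmod f ω p.2) (hmod f ω p.1) := by
    intro ω
    rw [integral_const_mul, ← norm_sq_int hf]
    have : Fr f ω = (1 / (2 * Real.pi)) • ∫ x, hmod f ω x := rfl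
    rw [this, norm_smul, mul_pow, Real.norm_eq_abs, sq_abs]
    ring
  simp_rw [hFr]
  rw [integral_const_mul]
  have hI : Integrable (Function.uncurry fun (ω : ℝ × ℝ) (p : (ℝ × ℝ) × (ℝ × ℝ)) =>
      Pker (eps * ω.1) (eps * ω.2) * inner ℝ (hmod f ω p.2) (hmod f ω p.1))
      (volume.prod volume) := by
    have hb := (int_Pker heps).mul_prod (hf.norm.mul_prod hf.norm)
    refine hb.mono ?_ (Filter.Eventually.of_forall fun p => ?_)
    · have c1 := cont_qexp qi
      have c2 := cont_qexp qj
      have m1 : AEStronglyMeasurable (fun q : (ℝ × ℝ) × ((ℝ × ℝ) × (ℝ × ℝ)) => f q.2.1)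
        (volume.prod volume) := (hf.1.comp_fst (ν := volume)).comp_snd
      have m2 : AEStronglyMeasurable (fun q : (ℝ × ℝ) × ((ℝ × ℝ) × (ℝ × ℝ)) => f q.2.2)
        (volume.prod volume) := (hf.1.comp_snd (μ := volume)).comp_snd
      have d1 : Continuous (fun q : (ℝ × ℝ) × ((ℝ × ℝ) × (ℝ × ℝ)) =>
        qexp qi (-(q.1.1 * q.2.1.1))) := by fun_prop
      have d2 : Continuous (fun q : (ℝ × ℝ) × ((ℝ × ℝ) × (ℝ × ℝ)) =>
        qexp qj (-(q.1.2 * q.2.1.2))) := by fun_prop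
      have d3 : Continuous (fun q : (ℝ × ℝ) × ((ℝ × ℝ) × (ℝ × ℝ)) =>
        qexp qi (-(q.1.1 * q.2.2.1))) := by fun_prop
      have d4 : Continuous (fun q : (ℝ × ℝ) × ((ℝ × ℝ) × (ℝ × ℝ)) =>
        qexp qj (-(q.1.2 * q.2.2.2))) := by fun_prop
      refine ((int_Pker heps).1.comp_fst).mul (AEStronglyMeasurable.inner ?_ ?_)
      · exact (m2.mul d3.aestronglyMeasurable).mul d4.aestronglyMeasurable
      · exact (m1.mul d1.aestronglyMeasurable).mul d2.aestronglyMeasurable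
    · simp only [Function.uncurry]
      rw [norm_mul, norm_mul]
      gcongr
      refine (norm_inner_le_norm _ _).trans ?_
      rw [norm_hmod, norm_hmod]
      simp [mul_comm]
  rw [integral_integral_swap hI, ← integral_const_mul]
  congr 1; ext p
  rw [int_omega heps]
  have := Real.pi_pos
  field_simp

lemma poisson_cont {eps : ℝ} (heps : 0 < eps) : Continuous (poisson eps) := by
  unfold poisson
  have : ∀ x : ℝ × ℝ, (eps ^ 2 + x.1 ^ 2) * (eps ^ 2 + x.2 ^ 2) ≠ 0 := by
    intro x; positivity
  fun_prop (disch := assumption)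

lemma poisson_bdd {eps : ℝ} (heps : 0 < eps) (x : ℝ × ℝ) :
    ‖poisson eps x‖ ≤ (1 / Real.pi ^ 2) * (eps ^ 2 / (eps ^ 2 * eps ^ 2)) := by
  have h0 : 0 ≤ poisson eps x := by unfold poisson; positivity
  rw [Real.norm_of_nonneg h0, poisson]
  gcongr <;> nlinarith [sq_nonneg x.1, sq_nonneg x.2]

lemma lhs_eq {f : ℝ × ℝ → Hq} (hf : Integrable f) {eps : ℝ} (heps : 0 < eps) :
    (∫ z : ℝ × ℝ, poisson eps (0 - z.1, 0 - z.2) •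
      ∫ y : ℝ × ℝ, star (f y) * f (z.1 + y.1, z.2 + y.2)).re =
    ∫ p : (ℝ × ℝ) × (ℝ × ℝ), poisson eps (p.1.1 - p.2.1, p.1.2 - p.2.2) *
      (star (f p.1) * f p.2).re := by
  have hs : Integrable (fun y => star (f y)) := by
    refine hf.mono (continuous_star.comp_aestronglyMeasurable hf.1)
      (Filter.Eventually.of_forall fun y => by simp)
  have hp := hs.mul_prod hf
  have pc := poisson_cont heps
  have hH : Integrable (fun p : (ℝ × ℝ) × (ℝ × ℝ) =>
      poisson eps (p.1.1 - p.2.1, p.1.2 - p.2.2) • (star (f p.1) * f p.2))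
      (volume.prod volume) := by
    refine hp.bdd_smul _ (Continuous.aestronglyMeasurable (by fun_prop))
      (Filter.Eventually.of_forall fun p => poisson_bdd heps _)
  have mp := measurePreserving_prod_add_swap (volume : Measure (ℝ × ℝ)) (volume : Measure (ℝ × ℝ))
  have hc := mp.integrable_comp_of_integrable hH
  have e1 : ∀ z : (ℝ × ℝ) × (ℝ × ℝ), ((fun p : (ℝ × ℝ) × (ℝ × ℝ) =>
      poisson eps (p.1.1 - p.2.1, p.1.2 - p.2.2) • (star (f p.1) * f p.2)) ∘
      (fun z : (ℝ × ℝ) × (ℝ × ℝ) => (z.2, z.2 + z.1))) z =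
      poisson eps (0 - z.1.1, 0 - z.1.2) • (star (f z.2) * f (z.1.1 + z.2.1, z.1.2 + z.2.2)) := by
    intro z
    have : z.2 + z.1 = (z.1.1 + z.2.1, z.1.2 + z.2.2) := by
      ext <;> simp [add_comm]
    simp only [Function.comp, this]
    congr 3
    all_goals ring_nf
  have e2 : ∫ z : ℝ × ℝ, poisson eps (0 - z.1, 0 - z.2) •
      ∫ y : ℝ × ℝ, star (f y) * f (z.1 + y.1, z.2 + y.2) =
      ∫ p : (ℝ × ℝ) × (ℝ × ℝ),
        poisson eps (p.1.1 - p.2.1, p.1.2 - p.2.2) • (star (f p.1) * f p.2) := by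
    simp_rw [← integral_smul]
    rw [Measure.volume_eq_prod (ℝ × ℝ) (ℝ × ℝ)]
    conv_rhs => rw [← mp.map_eq]
    rw [integral_map mp.measurable.aemeasurable (by rw [mp.map_eq]; exact hH.1)]
    have := integral_prod _ hc
    simp_rw [e1] at this
    rw [← this]
    exact (integral_congr_ae (Filter.Eventually.of_forall e1)).symm
  rw [e2]
  let L : Hq →L[ℝ] ℝ := LinearMap.toContinuousLinearMap
    { toFun := fun q => q.re, map_add' := fun _ _ => rfl, map_smul' := fun _ _ => by simp }
  have h := L.integral_comp_comm hH
  rw [Measure.volume_eq_prod (ℝ × ℝ) (ℝ × ℝ)]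
  refine Eq.trans h.symm ?_
  congr 1

theorem stmt1 (f : ℝ × ℝ → Hq) (hf : Integrable f)
    (g : ℝ × ℝ → Hq)
    (hg : ∀ x : ℝ × ℝ, g x = ∫ y : ℝ × ℝ, star (f y) * f (x.1 + y.1, x.2 + y.2))
    (eps : ℝ) (heps : 0 < eps) :
    (∫ y : ℝ × ℝ, poisson eps (0 - y.1, 0 - y.2) • g y).re =
      ∫ ω : ℝ × ℝ, Pker (eps * ω.1) (eps * ω.2) * ‖Fr f ω‖ ^ 2 := by
  simp_rw [hg]
  rw [lhs_eq hf heps, rhs_eq hf heps]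
end
end

section
/- (Inversion of the RQFT.) If f ∈ L¹(ℝ²,ℍ) and ℱ_r f ∈ L¹(ℝ²,ℍ), then f(x₁,x₂) = (1/(2π)) ∫_{ℝ²} (ℱ_r f)(ω₁,ω₂) e^{j ω₂ x₂} e^{i ω₁ x₁} dω₁ dω₂ for almost every (x₁,x₂) ∈ ℝ². -/
open MeasureTheory Real ENNReal

noncomputable section

open scoped FourierTransform ContDiff RealInnerProductSpace in
theorem aux_pair (g h : ℂ → ℂ) (hg : Integrable g) (hh : Integrable h) :
    ∫ x, 𝓕 g x * h x = ∫ x, g x * 𝓕 h x := by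
  have := VectorFourier.integral_fourierIntegral_smul_eq_flip (μ := volume) (ν := volume)
    (L := innerₗ ℂ) (f := g) (g := h) Real.continuous_fourierChar continuous_inner hg hh
  rw [flip_innerₗ] at this
  exact this

open scoped FourierTransform ContDiff RealInnerProductSpace in
theorem aux_pair_inv (g h : ℂ → ℂ) (hg : Integrable g) (hh : Integrable h) :
    ∫ x, 𝓕⁻ g x * h x = ∫ x, g x * 𝓕⁻ h x := by
  have h1 := aux_pair g (fun x => h (-x)) hg hh.comp_neg
  rw [Real.fourierInv_eq_fourier_comp_neg h, ← h1,
    ← integral_neg_eq_self (fun x => 𝓕 g x * h (-x))]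
  simp [Real.fourierInv_eq_fourier_neg]

open scoped FourierTransform ContDiff RealInnerProductSpace in
theorem aux_inv (g : ℂ → ℂ) (hg : Integrable g) (hG : Integrable (𝓕 g)) :
    ∀ᵐ x, g x = 𝓕⁻ (𝓕 g) x := by
  have hc : Continuous (𝓕⁻ (𝓕 g)) := by
    have h1 : Continuous (𝓕 (𝓕 g)) :=
      VectorFourier.fourierIntegral_continuous Real.continuous_fourierChar
        (L := innerₗ ℂ) continuous_inner hG
    have : 𝓕⁻ (𝓕 g) = fun x => 𝓕 (𝓕 g) (-x) := by
      ext x; exact Real.fourierInv_eq_fourier_neg _ _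
    rw [this]
    exact h1.comp continuous_neg
  refine ae_eq_of_integral_contDiff_smul_eq hg.locallyIntegrable hc.locallyIntegrable ?_
  intro φ hφ hφc
  have hs1 : HasCompactSupport (fun x => (φ x : ℂ)) := hφc.comp_left (g := ((↑) : ℝ → ℂ)) rfl
  have hs2 : ContDiff ℝ ∞ (fun x => (φ x : ℂ)) := Complex.ofRealCLM.contDiff.comp hφ
  set ψ := hs1.toSchwartzMap hs2 with hψ
  have hψx : ∀ x, ψ x = (φ x : ℂ) := fun x => rfl
  have e1 := aux_pair_inv (𝓕 g) ψ hG ψ.integrable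
  have i2 : Integrable (𝓕⁻ (ψ : ℂ → ℂ)) := by
    rw [← SchwartzMap.fourierInv_coe]; exact SchwartzMap.integrable _
  have e2 := aux_pair g (𝓕⁻ (ψ : ℂ → ℂ)) hg i2
  have e3 : 𝓕 (𝓕⁻ (ψ : ℂ → ℂ)) = ψ := by
    rw [← SchwartzMap.fourierInv_coe, ← SchwartzMap.fourier_coe, FourierTransform.fourier_fourierInv_eq]
  rw [e3] at e2
  rw [← e1] at e2
  simp only [hψx] at e2
  simp only [Complex.real_smul]
  simp only [mul_comm ((φ _ : ℝ) : ℂ)]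
  exact e2.symm

open scoped FourierTransform RealInnerProductSpace in
theorem aux_real2 (g : ℝ × ℝ → ℂ) (hg : Integrable g) (G : ℝ × ℝ → ℂ) (hG : Integrable G)
    (hGg : ∀ ω, G ω = ∫ x : ℝ × ℝ,
      Complex.exp (((-(ω.1 * x.1 + ω.2 * x.2) : ℝ) : ℂ) * Complex.I) * g x) :
    ∀ᵐ x : ℝ × ℝ, g x = ((1 / (2 * Real.pi)) ^ 2 : ℝ) •
      ∫ ω : ℝ × ℝ, Complex.exp (((ω.1 * x.1 + ω.2 * x.2 : ℝ) : ℂ) * Complex.I) * G ω := by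
  have mp := Complex.volume_preserving_equiv_real_prod
  set e := Complex.measurableEquivRealProd with he
  have he1 : ∀ z, (e z).1 = z.re := fun z => rfl
  have he2 : ∀ z, (e z).2 = z.im := fun z => rfl
  have hpi : (2 * Real.pi) ≠ 0 := by positivity
  have hin : ∀ z w : ℂ, ⟪z, w⟫ = z.re * w.re + z.im * w.im := by
    intro z w; simp [Complex.inner]; ring
  have hgc : Integrable (fun z => g (e z)) := mp.integrable_comp_of_integrable hg
  have hF : 𝓕 (fun z => g (e z)) = fun w => G ((2 * Real.pi) • e w) := by
    ext w
    rw [Real.fourier_eq', hGg, ← mp.integral_comp e.measurableEmbedding]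
    congr 1; ext v
    rw [smul_eq_mul, hin]
    simp only [Prod.smul_fst, Prod.smul_snd, smul_eq_mul, he1, he2]
    congr 4; ring
  have hFi : Integrable (𝓕 (fun z => g (e z))) := by
    rw [hF]
    exact mp.integrable_comp_of_integrable
      (g := fun w => G ((2 * Real.pi) • w)) (hG.comp_smul hpi)
  have key := aux_inv _ hgc hFi
  have key2 := mp.symm.quasiMeasurePreserving.ae key
  filter_upwards [key2] with x hx
  rw [MeasurableEquiv.apply_symm_apply] at hx
  rw [hx, hF, Real.fourierInv_eq']
  have h1 : ∀ v : ℂ, Complex.exp (((2 * Real.pi * ⟪v, e.symm x⟫ : ℝ) : ℂ) * Complex.I) •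
      G ((2 * Real.pi) • e v) = (fun ω : ℝ × ℝ =>
        Complex.exp (((ω.1 * x.1 + ω.2 * x.2 : ℝ) : ℂ) * Complex.I) * G ω)
          ((2 * Real.pi) • e v) := by
    intro v
    have a1 : (e.symm x).re = x.1 := rfl
    have a2 : (e.symm x).im = x.2 := rfl
    simp only [smul_eq_mul, hin, Prod.smul_fst, Prod.smul_snd, he1, he2, a1, a2]
    congr 4; ring
  simp_rw [h1]
  rw [mp.integral_comp e.measurableEmbedding (fun y => (fun ω : ℝ × ℝ =>
        Complex.exp (((ω.1 * x.1 + ω.2 * x.2 : ℝ) : ℂ) * Complex.I) * G ω)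
          ((2 * Real.pi) • y))]
  refine (Measure.integral_comp_smul volume (fun ω : ℝ × ℝ =>
    Complex.exp (((ω.1 * x.1 + ω.2 * x.2 : ℝ) : ℂ) * Complex.I) * G ω) (2 * Real.pi)).trans ?_
  congr 1
  rw [abs_of_nonneg (by positivity)]
  simp
  field_simp

/-- First complex coordinate of a quaternion, for right multiplication by `ℂ`. -/
def auxP : Hq →L[ℝ] ℂ :=
  LinearMap.toContinuousLinearMap
    { toFun := fun q => ⟨q.re, q.imI⟩
      map_add' := fun p q => by apply Complex.ext <;> simp
      map_smul' := fun p q => by apply Complex.ext <;> simp }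

theorem auxP_apply (q : Hq) : auxP q = ⟨q.re, q.imI⟩ := rfl

theorem q1c : (1 : Hq).re = 1 ∧ (1 : Hq).imI = 0 ∧ (1 : Hq).imJ = 0 ∧ (1 : Hq).imK = 0 :=
  ⟨rfl, rfl, rfl, rfl⟩

theorem qic : qi.re = 0 ∧ qi.imI = 1 ∧ qi.imJ = 0 ∧ qi.imK = 0 := ⟨rfl, rfl, rfl, rfl⟩

theorem qjc : qj.re = 0 ∧ qj.imI = 0 ∧ qj.imJ = 1 ∧ qj.imK = 0 := ⟨rfl, rfl, rfl, rfl⟩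

theorem auxP_mul (q : Hq) (t : ℝ) :
    auxP (q * qexp qi t) = Complex.exp ((t : ℂ) * Complex.I) * auxP q := by
  rw [auxP_apply, auxP_apply, Complex.exp_mul_I, ← Complex.ofReal_cos, ← Complex.ofReal_sin]
  apply Complex.ext <;> simp [qexp, qic, q1c, -Complex.ofReal_cos, -Complex.ofReal_sin] <;> ring

theorem aux_ext (p q : Hq) (h1 : auxP p = auxP q) (h2 : auxP (qj * p) = auxP (qj * q)) :
    p = q := by
  simp only [auxP_apply, Complex.mk.injEq] at h1 h2
  obtain ⟨a, b⟩ := h1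
  obtain ⟨c, d⟩ := h2
  simp [qjc] at c d
  ext <;> assumption

theorem qexp_cont (u : Hq) {X : Type*} [TopologicalSpace X] (φ : X → ℝ) (hφ : Continuous φ) :
    Continuous fun x => qexp u (φ x) := by
  unfold qexp; fun_prop

theorem qexp_norm_le (u : Hq) (t : ℝ) : ‖qexp u t‖ ≤ 1 + ‖u‖ := by
  unfold qexp
  refine (norm_add_le _ _).trans ?_
  rw [norm_smul, norm_smul, norm_one, mul_one]
  have := Real.abs_cos_le_one t
  have := Real.abs_sin_le_one t
  simp only [Real.norm_eq_abs]
  nlinarith [norm_nonneg u]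

theorem qexp_int (u : Hq) (f : ℝ × ℝ → Hq) (hf : Integrable f) (φ : ℝ × ℝ → ℝ)
    (hφ : Continuous φ) : Integrable fun x => f x * qexp u (φ x) :=
  hf.mul_bdd (c := 1 + ‖u‖) (qexp_cont u φ hφ).aestronglyMeasurable
    (Filter.Eventually.of_forall fun _ => qexp_norm_le u _)

theorem qexp_id1 (t : ℝ) :
    qexp qj (-t) * ((1 / 2 : ℝ) • (1 - qj * qi)) + qexp qj t * ((1 / 2 : ℝ) • (1 + qj * qi))
      = qexp qi (-t) := by
  ext <;> simp [qexp, qic, qjc, q1c] <;> ring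

theorem qexp_id2 (t : ℝ) :
    ((1 / 2 : ℝ) • (1 - qj * qi)) * qexp qi t + ((1 / 2 : ℝ) • (1 + qj * qi)) * qexp qi (-t)
      = qexp qj t := by
  ext <;> simp [qexp, qic, qjc, q1c] <;> ring

theorem qexp_add (s t : ℝ) : qexp qi (s + t) = qexp qi t * qexp qi s := by
  ext <;> simp [qexp, qic, q1c, Real.cos_add, Real.sin_add] <;> ring

theorem flip_mp : MeasurePreserving (fun ω : ℝ × ℝ => (ω.1, -ω.2)) :=
  (MeasurePreserving.id volume).prod (Measure.measurePreserving_neg volume)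

theorem flip_emb : MeasurableEmbedding (fun ω : ℝ × ℝ => (ω.1, -ω.2)) :=
  ((MeasurableEquiv.refl ℝ).prodCongr (MeasurableEquiv.neg ℝ)).measurableEmbedding

/-- The `i`-complex Fourier transform expressed through `Fr`. -/
def auxH (f : ℝ × ℝ → Hq) (ω : ℝ × ℝ) : Hq :=
  Fr f ω * ((1 / 2 : ℝ) • (1 - qj * qi)) + Fr f (ω.1, -ω.2) * ((1 / 2 : ℝ) • (1 + qj * qi))

theorem auxH_int (f : ℝ × ℝ → Hq) (hFf : Integrable (Fr f)) : Integrable (auxH f) :=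
  (hFf.mul_const _).add ((flip_mp.integrable_comp_of_integrable hFf).mul_const _)

theorem auxH_eq (f : ℝ × ℝ → Hq) (hf : Integrable f) (ω : ℝ × ℝ) :
    auxH f ω = (1 / (2 * Real.pi)) •
      ∫ x : ℝ × ℝ, f x * qexp qi (-(ω.1 * x.1 + ω.2 * x.2)) := by
  have hi : ∀ a b : ℝ, Integrable fun x : ℝ × ℝ =>
      f x * qexp qi (-(a * x.1)) * qexp qj (-(b * x.2)) := fun a b =>
    qexp_int _ _ (qexp_int _ _ hf _ (by fun_prop)) _ (by fun_prop)
  unfold auxH Fr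
  simp only []
  rw [smul_mul_assoc, smul_mul_assoc, ← integral_mul_const_of_integrable (hi _ _),
    ← integral_mul_const_of_integrable (hi _ _), ← smul_add,
    ← integral_add ((hi _ _).mul_const _) ((hi _ _).mul_const _)]
  congr 2; ext1 x
  have := qexp_id1 (ω.2 * x.2)
  rw [neg_add_rev, qexp_add, ← this, neg_mul, neg_neg]
  simp only [mul_add, mul_assoc]

theorem auxH_inv (f : ℝ × ℝ → Hq) (hFf : Integrable (Fr f)) (x : ℝ × ℝ) :
    ∫ ω : ℝ × ℝ, auxH f ω * qexp qi (ω.1 * x.1 + ω.2 * x.2) =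
      ∫ ω : ℝ × ℝ, Fr f ω * qexp qj (ω.2 * x.2) * qexp qi (ω.1 * x.1) := by
  have i1 : Integrable fun ω : ℝ × ℝ => Fr f ω * ((1 / 2 : ℝ) • (1 - qj * qi)) *
      qexp qi (ω.1 * x.1 + ω.2 * x.2) :=
    qexp_int _ _ (hFf.mul_const _) _ (by fun_prop)
  have i2 : Integrable fun ω : ℝ × ℝ => Fr f ω * ((1 / 2 : ℝ) • (1 + qj * qi)) *
      qexp qi (ω.1 * x.1 + -ω.2 * x.2) :=
    qexp_int _ _ (hFf.mul_const _) _ (by fun_prop)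
  have e2 := flip_mp.integral_comp flip_emb (fun ω : ℝ × ℝ =>
    Fr f ω * ((1 / 2 : ℝ) • (1 + qj * qi)) * qexp qi (ω.1 * x.1 + -ω.2 * x.2))
  have i3 := flip_mp.integrable_comp_of_integrable i2
  simp only [Function.comp_def, neg_neg] at e2 i3
  unfold auxH
  simp only [add_mul]
  rw [integral_add i1 i3, e2, ← integral_add i1 i2]
  congr 1; ext1 ω
  rw [← qexp_id2 (ω.2 * x.2), qexp_add, qexp_add, neg_mul]
  simp only [mul_add, add_mul, mul_assoc]

theorem aux_main (c : Hq) (f : ℝ × ℝ → Hq) (hf : Integrable f) (hFf : Integrable (Fr f)) :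
    ∀ᵐ x : ℝ × ℝ, auxP (c * f x) = auxP (c * ((1 / (2 * Real.pi)) •
        ∫ ω : ℝ × ℝ, Fr f ω * qexp qj (ω.2 * x.2) * qexp qi (ω.1 * x.1))) := by
  have hpi : (2 * Real.pi) ≠ 0 := by positivity
  have hH := auxH_int f hFf
  have key := aux_real2 (fun x => auxP (c * f x)) (auxP.integrable_comp (hf.const_mul c))
    (fun ω => (2 * Real.pi) • auxP (c * auxH f ω))
    ((auxP.integrable_comp (hH.const_mul c)).smul (2 * Real.pi)) ?_
  · filter_upwards [key] with x hx
    rw [hx, ← auxH_inv f hFf]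
    have i := qexp_int qi _ hH (fun ω => ω.1 * x.1 + ω.2 * x.2) (by fun_prop)
    rw [mul_smul_comm, map_smul, ← integral_const_mul_of_integrable i,
      ← auxP.integral_comp_comm (i.const_mul c)]
    simp only [← mul_assoc, auxP_mul, mul_smul_comm]
    rw [integral_smul, smul_smul]
    congr 1
    field_simp
  · intro ω
    have i := qexp_int qi _ hf (fun x => -(ω.1 * x.1 + ω.2 * x.2)) (by fun_prop)
    rw [auxH_eq f hf, mul_smul_comm, map_smul, ← integral_const_mul_of_integrable i,
      ← auxP.integral_comp_comm (i.const_mul c), smul_smul]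
    simp only [← mul_assoc, auxP_mul]
    rw [mul_one_div_cancel hpi, one_smul]

theorem stmt2 (f : ℝ × ℝ → Hq) (hf : Integrable f) (hFf : Integrable (Fr f)) :
    ∀ᵐ x : ℝ × ℝ, f x =
      (1 / (2 * Real.pi)) •
        ∫ ω : ℝ × ℝ, Fr f ω * qexp qj (ω.2 * x.2) * qexp qi (ω.1 * x.1) := by

  filter_upwards [aux_main 1 f hf hFf, aux_main qj f hf hFf] with x h1 h2
  rw [one_mul, one_mul] at h1
  exact aux_ext _ _ h1 h2
end
end

section
/- (Uniqueness of the RQFT.) If f, g ∈ L¹(ℝ²,ℍ) and (ℱ_r f)(ω₁,ω₂) = (ℱ_r g)(ω₁,ω₂) for almost every (ω₁,ω₂) ∈ ℝ², then f(x₁,x₂) = g(x₁,x₂) for almost every (x₁,x₂) ∈ ℝ². -/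
open MeasureTheory Real ENNReal

noncomputable section

lemma real_fourier_zero (u : ℝ × ℝ → ℝ) (hu : Integrable u)
    (hc : ∀ a b : ℝ, ∫ x : ℝ × ℝ, Real.cos (a * x.1 + b * x.2) * u x = 0)
    (hs : ∀ a b : ℝ, ∫ x : ℝ × ℝ, Real.sin (a * x.1 + b * x.2) * u x = 0) :
    u =ᵐ[volume] 0 := by
  have hm1 : AEMeasurable (fun x => ENNReal.ofReal (u x)) := hu.1.aemeasurable.ennreal_ofReal
  have hm2 : AEMeasurable (fun x => ENNReal.ofReal (-u x)) := hu.1.aemeasurable.neg.ennreal_ofReal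
  have : IsFiniteMeasure (volume.withDensity (fun x => ENNReal.ofReal (u x))) :=
    isFiniteMeasure_withDensity_ofReal hu.2
  have : IsFiniteMeasure (volume.withDensity (fun x => ENNReal.ofReal (-u x))) :=
    isFiniteMeasure_withDensity_ofReal hu.neg.2
  have key : volume.withDensity (fun x => ENNReal.ofReal (u x))
      = volume.withDensity (fun x => ENNReal.ofReal (-u x)) := by
    apply Measure.ext_of_charFunDual
    ext L
    rw [charFunDual_apply, charFunDual_apply,
      integral_withDensity_eq_integral_toReal_smul₀ hm1 (by simp),
      integral_withDensity_eq_integral_toReal_smul₀ hm2 (by simp), ← sub_eq_zero]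
    have hL : ∀ x : ℝ × ℝ, L x = L (1, 0) * x.1 + L (0, 1) * x.2 := by
      intro x
      have : x = x.1 • ((1, 0) : ℝ × ℝ) + x.2 • ((0, 1) : ℝ × ℝ) := by ext <;> simp
      conv_lhs => rw [this]
      rw [map_add, map_smul, map_smul, smul_eq_mul, smul_eq_mul]; ring
    have hcont : Continuous (fun x : ℝ × ℝ => Complex.exp (L x * Complex.I)) := by fun_prop
    have hb : ∀ x : ℝ × ℝ, ‖Complex.exp (L x * Complex.I)‖ ≤ 1 := fun x =>
      (Complex.norm_exp_ofReal_mul_I _).le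
    have hi : ∀ v : ℝ × ℝ → ℝ, Integrable v →
        Integrable (fun x => v x • Complex.exp (L x * Complex.I)) := by
      intro v hv
      refine hv.norm.mono' (hv.1.smul hcont.aestronglyMeasurable) (.of_forall fun x => ?_)
      rw [norm_smul]
      exact mul_le_of_le_one_right (norm_nonneg _) (hb x)
    rw [← integral_sub]
    · have e : ∀ x, (ENNReal.ofReal (u x)).toReal • Complex.exp (L x * Complex.I)
          - (ENNReal.ofReal (-u x)).toReal • Complex.exp (L x * Complex.I)
          = u x • Complex.exp (L x * Complex.I) := by
        intro x
        rw [← sub_smul, ENNReal.toReal_ofReal', ENNReal.toReal_ofReal']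
        congr 1
        rcases le_total (u x) 0 with h | h
        · rw [max_eq_right h, max_eq_left (by linarith)]; ring
        · rw [max_eq_left h, max_eq_right (by linarith)]; ring
      simp_rw [e]
      have h1 := hi u hu
      apply Complex.ext
      · have := (Complex.reCLM.integral_comp_comm h1).symm
        simp only [Complex.reCLM_apply] at this
        rw [this, Complex.zero_re, ← hc (L (1, 0)) (L (0, 1))]
        congr 1; ext x
        rw [Complex.smul_re, Complex.exp_ofReal_mul_I_re, hL, smul_eq_mul, mul_comm]
      · have := (Complex.imCLM.integral_comp_comm h1).symm
        simp only [Complex.imCLM_apply] at this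
        rw [this, Complex.zero_im, ← hs (L (1, 0)) (L (0, 1))]
        congr 1; ext x
        rw [Complex.smul_im, Complex.exp_ofReal_mul_I_im, hL, smul_eq_mul, mul_comm]
    · apply hi
      simp_rw [ENNReal.toReal_ofReal']
      exact hu.pos_part
    · apply hi
      simp_rw [ENNReal.toReal_ofReal']
      exact hu.neg.pos_part
  rw [withDensity_eq_iff hm1 hm2 (by
    have := hu.lintegral_lt_top
    exact this.ne)] at key
  filter_upwards [key] with x hx
  have := congrArg ENNReal.toReal hx
  rw [ENNReal.toReal_ofReal', ENNReal.toReal_ofReal'] at this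
  rcases le_total (u x) 0 with h | h
  · rw [max_eq_right h, max_eq_left (by linarith)] at this; simp; linarith
  · rw [max_eq_left h, max_eq_right (by linarith)] at this; simpa using this

lemma quat_fourier_zero (u : ℝ × ℝ → Hq) (hu : Integrable u)
    (hc : ∀ a b : ℝ, ∫ x : ℝ × ℝ, Real.cos (a * x.1 + b * x.2) • u x = 0)
    (hs : ∀ a b : ℝ, ∫ x : ℝ × ℝ, Real.sin (a * x.1 + b * x.2) • u x = 0) :
    u =ᵐ[volume] 0 := by
  have aux : ∀ P : Hq →ₗ[ℝ] ℝ, (fun x => P (u x)) =ᵐ[volume] 0 := by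
    intro P'
    let P : Hq →L[ℝ] ℝ := LinearMap.toContinuousLinearMap P'
    have hi : ∀ φ : ℝ × ℝ → ℝ, Continuous φ → (∀ x, |φ x| ≤ 1) → 
        ∫ x, φ x • u x = 0 → ∫ x, φ x * P (u x) = 0 := by
      intro φ h1 h2 h3
      have : Integrable (fun x => φ x • u x) := by
        refine hu.norm.mono' (h1.aestronglyMeasurable.smul hu.1) (.of_forall fun x => ?_)
        rw [norm_smul]
        exact mul_le_of_le_one_left (norm_nonneg _) (h2 x)
      have := P.integral_comp_comm this
      rw [h3, map_zero] at this
      simpa using this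
    exact real_fourier_zero (fun x => P (u x)) (P.integrable_comp hu)
      (fun a b => hi _ (by fun_prop) (fun x => Real.abs_cos_le_one _) (hc a b))
      (fun a b => hi _ (by fun_prop) (fun x => Real.abs_sin_le_one _) (hs a b))
  filter_upwards [aux (QuaternionAlgebra.reₗ _ _ _), aux (QuaternionAlgebra.imIₗ _ _ _),
    aux (QuaternionAlgebra.imJₗ _ _ _), aux (QuaternionAlgebra.imKₗ _ _ _)] with x h1 h2 h3 h4
  exact Quaternion.ext _ _ h1 h2 h3 h4

lemma norm_qexp_le (q : Hq) (t : ℝ) : ‖qexp q t‖ ≤ 1 + ‖q‖ := by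
  unfold qexp
  refine (norm_add_le _ _).trans ?_
  rw [norm_smul, norm_smul, norm_one, mul_one]
  exact add_le_add (Real.abs_cos_le_one _)
    (mul_le_of_le_one_left (norm_nonneg _) (Real.abs_sin_le_one _))

lemma continuous_qexp (q : Hq) : Continuous (qexp q) := by
  unfold qexp; fun_prop

lemma kernel_bound (f : ℝ × ℝ → Hq) (ω x : ℝ × ℝ) :
    ‖f x * qexp qi (-(ω.1 * x.1)) * qexp qj (-(ω.2 * x.2))‖
      ≤ ‖f x‖ * (1 + ‖qi‖) * (1 + ‖qj‖) := by
  rw [norm_mul, norm_mul]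
  gcongr
  · exact norm_qexp_le _ _
  · exact norm_qexp_le _ _

lemma kernel_meas (f : ℝ × ℝ → Hq) (hf : Integrable f) (ω : ℝ × ℝ) :
    AEStronglyMeasurable (fun x : ℝ × ℝ =>
      f x * qexp qi (-(ω.1 * x.1)) * qexp qj (-(ω.2 * x.2))) volume := by
  have h1 : Continuous (fun x : ℝ × ℝ => qexp qi (-(ω.1 * x.1))) :=
    (continuous_qexp qi).comp (by fun_prop)
  have h2 : Continuous (fun x : ℝ × ℝ => qexp qj (-(ω.2 * x.2))) :=
    (continuous_qexp qj).comp (by fun_prop)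
  exact (hf.1.mul h1.aestronglyMeasurable).mul h2.aestronglyMeasurable

lemma kernel_int (f : ℝ × ℝ → Hq) (hf : Integrable f) (ω : ℝ × ℝ) :
    Integrable (fun x : ℝ × ℝ =>
      f x * qexp qi (-(ω.1 * x.1)) * qexp qj (-(ω.2 * x.2))) volume :=
  ((hf.norm.mul_const _).mul_const _).mono' (kernel_meas f hf ω)
    (.of_forall (kernel_bound f ω))

lemma Fr_continuous (f : ℝ × ℝ → Hq) (hf : Integrable f) : Continuous (Fr f) := by
  unfold Fr
  suffices hI : Continuous (fun ω : ℝ × ℝ => ∫ x : ℝ × ℝ,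
      f x * qexp qi (-(ω.1 * x.1)) * qexp qj (-(ω.2 * x.2))) from
    hI.const_smul (1 / (2 * Real.pi))
  refine continuous_of_dominated (kernel_meas f hf) (fun ω => .of_forall (kernel_bound f ω))
    ((hf.norm.mul_const _).mul_const _) (.of_forall fun x => ?_)
  have h1 : Continuous (fun ω : ℝ × ℝ => qexp qi (-(ω.1 * x.1))) :=
    (continuous_qexp qi).comp (by fun_prop)
  have h2 : Continuous (fun ω : ℝ × ℝ => qexp qj (-(ω.2 * x.2))) :=
    (continuous_qexp qj).comp (by fun_prop)
  have h3 : Continuous (fun _ : ℝ × ℝ => f x) := continuous_const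
  exact (h3.mul h1).mul h2

lemma kernel_expand (u : ℝ × ℝ → Hq) (hu : Integrable u) (a b : ℝ) :
    ∫ x : ℝ × ℝ, u x * qexp qi (-(a * x.1)) * qexp qj (-(b * x.2)) =
      (∫ x : ℝ × ℝ, (Real.cos (a * x.1) * Real.cos (b * x.2)) • u x)
      - (∫ x : ℝ × ℝ, (Real.sin (a * x.1) * Real.cos (b * x.2)) • u x) * qi
      - (∫ x : ℝ × ℝ, (Real.cos (a * x.1) * Real.sin (b * x.2)) • u x) * qj
      + (∫ x : ℝ × ℝ, (Real.sin (a * x.1) * Real.sin (b * x.2)) • u x) * (qi * qj) := by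
  have hi : ∀ φ : ℝ × ℝ → ℝ, Continuous φ → (∀ x, |φ x| ≤ 1) →
      Integrable (fun x => φ x • u x) := by
    intro φ h1 h2
    refine hu.norm.mono' (h1.aestronglyMeasurable.smul hu.1) (.of_forall fun x => ?_)
    rw [norm_smul]
    exact mul_le_of_le_one_left (norm_nonneg _) (h2 x)
  have hp : ∀ s t : ℝ, |s| ≤ 1 → |t| ≤ 1 → |s * t| ≤ 1 := fun s t h1 h2 => by
    rw [abs_mul]; exact mul_le_one₀ h1 (abs_nonneg _) h2
  have i1 := hi (fun x => Real.cos (a * x.1) * Real.cos (b * x.2)) (by fun_prop)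
    (fun x => hp _ _ (Real.abs_cos_le_one _) (Real.abs_cos_le_one _))
  have i2 := (hi (fun x => Real.sin (a * x.1) * Real.cos (b * x.2)) (by fun_prop)
    (fun x => hp _ _ (Real.abs_sin_le_one _) (Real.abs_cos_le_one _))).mul_const qi
  have i3 := (hi (fun x => Real.cos (a * x.1) * Real.sin (b * x.2)) (by fun_prop)
    (fun x => hp _ _ (Real.abs_cos_le_one _) (Real.abs_sin_le_one _))).mul_const qj
  have i4 := (hi (fun x => Real.sin (a * x.1) * Real.sin (b * x.2)) (by fun_prop)
    (fun x => hp _ _ (Real.abs_sin_le_one _) (Real.abs_sin_le_one _))).mul_const (qi * qj)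
  have i12 : Integrable (fun x : ℝ × ℝ => (Real.cos (a * x.1) * Real.cos (b * x.2)) • u x
      - (Real.sin (a * x.1) * Real.cos (b * x.2)) • u x * qi) := i1.sub i2
  have i123 : Integrable (fun x : ℝ × ℝ => (Real.cos (a * x.1) * Real.cos (b * x.2)) • u x
      - (Real.sin (a * x.1) * Real.cos (b * x.2)) • u x * qi
      - (Real.cos (a * x.1) * Real.sin (b * x.2)) • u x * qj) := i12.sub i3
  have hmc : ∀ (v : ℝ × ℝ → Hq) (q : Hq), Integrable v → (∫ x, v x) * q = ∫ x, v x * q :=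
    fun v q hv => (((ContinuousLinearMap.mul ℝ Hq).flip q).integral_comp_comm hv).symm
  rw [hmc _ _ (hi _ (by fun_prop)
      (fun x => hp _ _ (Real.abs_sin_le_one _) (Real.abs_cos_le_one _))),
    hmc _ _ (hi _ (by fun_prop)
      (fun x => hp _ _ (Real.abs_cos_le_one _) (Real.abs_sin_le_one _))),
    hmc _ _ (hi _ (by fun_prop)
      (fun x => hp _ _ (Real.abs_sin_le_one _) (Real.abs_sin_le_one _))),
    ← integral_sub i1 i2, ← integral_sub i12 i3, ← integral_add i123 i4]
  congr 1; ext1 x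
  simp only [qexp, Real.cos_neg, Real.sin_neg, mul_add, add_mul, mul_smul_comm, smul_mul_assoc,
    mul_one, neg_smul, mul_neg, neg_mul, smul_add, smul_neg, mul_assoc, smul_smul]
  simp only [mul_comm (Real.cos (b * x.2)), mul_comm (Real.sin (b * x.2))]
  abel

theorem stmt3 (f g : ℝ × ℝ → Hq) (hf : Integrable f) (hg : Integrable g)
    (h : Fr f =ᵐ[volume] Fr g) : f =ᵐ[volume] g := by
  have hu : Integrable (fun x => f x - g x) := hf.sub hg
  have hE : Fr f = Fr g :=
    ((Fr_continuous f hf).ae_eq_iff_eq volume (Fr_continuous g hg)).1 h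
  have hz : ∀ a b : ℝ,
      ∫ x : ℝ × ℝ, (f x - g x) * qexp qi (-(a * x.1)) * qexp qj (-(b * x.2)) = 0 := by
    intro a b
    have h1 := congrFun hE (a, b)
    unfold Fr at h1
    have h2 := smul_right_injective Hq (r := 1 / (2 * Real.pi)) (by positivity) h1
    simp_rw [sub_mul]
    rw [integral_sub (kernel_int f hf (a, b)) (kernel_int g hg (a, b))]
    exact sub_eq_zero.2 h2
  have hqi : qi ≠ 0 := fun h => by
    have := congrArg (fun q : Hq => q.imI) h
    exact one_ne_zero (α := ℝ) this
  have hqj : qj ≠ 0 := fun h => by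
    have := congrArg (fun q : Hq => q.imJ) h
    exact one_ne_zero (α := ℝ) this
  have all : ∀ a b : ℝ,
      (∫ x : ℝ × ℝ, (Real.cos (a * x.1) * Real.cos (b * x.2)) • (f x - g x)) = 0 ∧
      (∫ x : ℝ × ℝ, (Real.sin (a * x.1) * Real.cos (b * x.2)) • (f x - g x)) = 0 ∧
      (∫ x : ℝ × ℝ, (Real.cos (a * x.1) * Real.sin (b * x.2)) • (f x - g x)) = 0 ∧
      (∫ x : ℝ × ℝ, (Real.sin (a * x.1) * Real.sin (b * x.2)) • (f x - g x)) = 0 := by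
    intro a b
    have e1 := hz a b
    have e2 := hz (-a) b
    have e3 := hz a (-b)
    have e4 := hz (-a) (-b)
    rw [kernel_expand _ hu] at e1 e2 e3 e4
    simp only [neg_mul, mul_neg, Real.cos_neg, Real.sin_neg, neg_smul, integral_neg, neg_neg]
      at e2 e3 e4
    generalize (∫ x : ℝ × ℝ, (Real.cos (a * x.1) * Real.cos (b * x.2)) • (f x - g x)) = A at *
    generalize (∫ x : ℝ × ℝ, (Real.sin (a * x.1) * Real.cos (b * x.2)) • (f x - g x)) = B at *
    generalize (∫ x : ℝ × ℝ, (Real.cos (a * x.1) * Real.sin (b * x.2)) • (f x - g x)) = C at *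
    generalize (∫ x : ℝ × ℝ, (Real.sin (a * x.1) * Real.sin (b * x.2)) • (f x - g x)) = D at *
    have hB : B = 0 ∨ qi = 0 := mul_eq_zero.1 (by
      generalize B * qi = B' at *
      generalize C * qj = C' at *
      generalize D * (qi * qj) = D' at *
      linear_combination (norm := module) (1/4 : ℝ) • (-e1 + e2 - e3 + e4))
    have hC : C = 0 ∨ qj = 0 := mul_eq_zero.1 (by
      generalize B * qi = B' at *
      generalize C * qj = C' at *
      generalize D * (qi * qj) = D' at *
      linear_combination (norm := module) (1/4 : ℝ) • (-e1 - e2 + e3 + e4))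
    have hD : D = 0 ∨ qi * qj = 0 := mul_eq_zero.1 (by
      generalize B * qi = B' at *
      generalize C * qj = C' at *
      generalize D * (qi * qj) = D' at *
      linear_combination (norm := module) (1/4 : ℝ) • (e1 - e2 - e3 + e4))
    have hB := hB.resolve_right hqi
    have hC := hC.resolve_right hqj
    have hD := hD.resolve_right (mul_ne_zero hqi hqj)
    subst hB hC hD
    refine ⟨by simpa using e1, rfl, rfl, rfl⟩
  have hi : ∀ φ ψ : ℝ → ℝ, Continuous φ → Continuous ψ → (∀ x, |φ x| ≤ 1) → (∀ x, |ψ x| ≤ 1) →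
      ∀ a b : ℝ, Integrable (fun x : ℝ × ℝ => (φ (a * x.1) * ψ (b * x.2)) • (f x - g x)) := by
    intro φ ψ c1 c2 h1 h2 a b
    have hc : Continuous (fun x : ℝ × ℝ => φ (a * x.1) * ψ (b * x.2)) := by fun_prop
    refine hu.norm.mono' (hc.aestronglyMeasurable.smul hu.1) (.of_forall fun x => ?_)
    rw [norm_smul, Real.norm_eq_abs, abs_mul]
    exact mul_le_of_le_one_left (norm_nonneg _) (mul_le_one₀ (h1 _) (abs_nonneg _) (h2 _))
  have hcos := Real.abs_cos_le_one
  have hsin := Real.abs_sin_le_one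
  have cc := Real.continuous_cos
  have cs := Real.continuous_sin
  have fin := quat_fourier_zero _ hu
    (fun a b => by
      simp_rw [Real.cos_add, sub_smul]
      rw [integral_sub (hi _ _ cc cc hcos hcos a b) (hi _ _ cs cs hsin hsin a b),
        (all a b).1, (all a b).2.2.2, sub_zero])
    (fun a b => by
      simp_rw [Real.sin_add, add_smul]
      rw [integral_add (hi _ _ cs cc hsin hcos a b) (hi _ _ cc cs hcos hsin a b),
        (all a b).2.1, (all a b).2.2.1, add_zero])
  filter_upwards [fin] with x hx
  exact sub_eq_zero.1 hx
end
end

section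
/- (The RQFT extends to a unitary operator on L².) There exists a map Ψ_r : L²(ℝ²,ℍ) → L²(ℝ²,ℍ) which is left ℍ-linear (Ψ_r(q·f + g) = q·Ψ_r f + Ψ_r g for all q ∈ ℍ), satisfies ‖Ψ_r f‖₂ = ‖f‖₂ for all f ∈ L²(ℝ²,ℍ), is surjective onto L²(ℝ²,ℍ), and agrees almost everywhere with ℱ_r on L¹(ℝ²,ℍ) ∩ L²(ℝ²,ℍ). -/
open MeasureTheory Real ENNReal

noncomputable section

open scoped FourierTransform SchwartzMap in
lemma fourier_L1L2 {E F : Type*}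
    [NormedAddCommGroup E] [MeasurableSpace E] [BorelSpace E]
    [NormedAddCommGroup F] [InnerProductSpace ℂ F] [CompleteSpace F]
    [InnerProductSpace ℝ E] [FiniteDimensional ℝ E]
    (f : Lp (α := E) F 2) (hf : Integrable (f : E → F)) :
    ((MeasureTheory.Lp.fourierTransformₗᵢ E F f : Lp (α := E) F 2) : E → F)
      =ᵐ[volume] 𝓕 (f : E → F) := by
  have hcont : Continuous (𝓕 (f : E → F)) :=
    VectorFourier.fourierIntegral_continuous Real.continuous_fourierChar
      (by exact continuous_inner) hf
  apply ae_eq_of_integral_contDiff_smul_eq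
  · exact (Lp.memLp _).locallyIntegrable (by norm_num)
  · exact hcont.locallyIntegrable
  · intro g g_smooth g_cpt
    have hg₁ : HasCompactSupport (Complex.ofRealCLM ∘ g) := g_cpt.comp_left rfl
    have hg₂ : ContDiff ℝ (⊤ : ℕ∞) (Complex.ofRealCLM ∘ g) := by fun_prop
    have key := MeasureTheory.Lp.fourier_toTemperedDistribution_eq f
    have k2 := DFunLike.congr_fun key (hg₁.toSchwartzMap hg₂)
    rw [TemperedDistribution.fourier_apply, Lp.toTemperedDistribution_apply,
      Lp.toTemperedDistribution_apply] at k2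
    have k3 := VectorFourier.integral_fourierIntegral_smul_eq_flip (L := innerₗ E)
      (f := (hg₁.toSchwartzMap hg₂ : E → ℂ)) (g := (f : E → F)) (μ := volume) (ν := volume)
      Real.continuous_fourierChar continuous_inner (SchwartzMap.integrable _) hf
    have k4 : ∀ x, (hg₁.toSchwartzMap hg₂ : E → ℂ) x = (g x : ℂ) := fun x => rfl
    rw [flip_innerₗ] at k3
    simp only [k4, Complex.coe_smul] at k2 k3
    refine k2.symm.trans (Eq.trans ?_ k3)
    rfl

/-- Quaternions with right complex structure. -/
def HC : Type := Quaternion ℝ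

instance : NormedAddCommGroup HC := inferInstanceAs (NormedAddCommGroup (Quaternion ℝ))
instance : CompleteSpace HC := inferInstanceAs (CompleteSpace (Quaternion ℝ))

def toHC (q : Hq) : HC := q
def ofHC (q : HC) : Hq := q

def c2q (z : ℂ) : Hq := ⟨z.re, z.im, 0, 0⟩

@[simp] lemma c2q_re (z : ℂ) : (c2q z).re = z.re := rfl
@[simp] lemma c2q_imI (z : ℂ) : (c2q z).imI = z.im := rfl
@[simp] lemma c2q_imJ (z : ℂ) : (c2q z).imJ = 0 := rfl
@[simp] lemma c2q_imK (z : ℂ) : (c2q z).imK = 0 := rfl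

@[simp] lemma qi_re : qi.re = 0 := rfl
@[simp] lemma qi_imI : qi.imI = 1 := rfl
@[simp] lemma qi_imJ : qi.imJ = 0 := rfl
@[simp] lemma qi_imK : qi.imK = 0 := rfl
@[simp] lemma qj_re : qj.re = 0 := rfl
@[simp] lemma qj_imI : qj.imI = 0 := rfl
@[simp] lemma qj_imJ : qj.imJ = 1 := rfl
@[simp] lemma qj_imK : qj.imK = 0 := rfl
@[simp] lemma qk_re : qk.re = 0 := rfl
@[simp] lemma qk_imI : qk.imI = 0 := rfl
@[simp] lemma qk_imJ : qk.imJ = 0 := rfl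
@[simp] lemma qk_imK : qk.imK = 1 := rfl
@[simp] lemma hq_one_re : (1 : Hq).re = 1 := rfl
@[simp] lemma hq_one_imI : (1 : Hq).imI = 0 := rfl
@[simp] lemma hq_one_imJ : (1 : Hq).imJ = 0 := rfl
@[simp] lemma hq_one_imK : (1 : Hq).imK = 0 := rfl

instance : SMul ℂ HC := ⟨fun z q => toHC (ofHC q * c2q z)⟩
instance : Inner ℂ HC := ⟨fun x y => ⟨(star (ofHC x) * ofHC y).re, (star (ofHC x) * ofHC y).imI⟩⟩

lemma ofHC_smul (z : ℂ) (q : HC) : ofHC (z • q) = ofHC q * c2q z := rfl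
lemma ofHC_add (p q : HC) : ofHC (p + q) = ofHC p + ofHC q := rfl
lemma ofHC_zero : ofHC 0 = 0 := rfl
lemma ofHC_inj {p q : HC} (h : ofHC p = ofHC q) : p = q := h
lemma norm_ofHC (p : HC) : ‖ofHC p‖ = ‖p‖ := rfl

lemma norm_c2q (z : ℂ) : ‖c2q z‖ = ‖z‖ := by
  have h1 : ‖c2q z‖ * ‖c2q z‖ = ‖z‖ * ‖z‖ := by
    rw [← Quaternion.normSq_eq_norm_mul_self, ← Complex.normSq_eq_norm_sq z |>.trans (sq _),
      Quaternion.normSq_def', Complex.normSq_apply]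
    simp; ring
  nlinarith [norm_nonneg (c2q z), norm_nonneg z, mul_self_inj (norm_nonneg (c2q z)) (norm_nonneg z) |>.1 h1]

instance : Module ℂ HC where
  one_smul q := ofHC_inj (by rw [ofHC_smul]; ext <;> simp)
  mul_smul z w q := ofHC_inj (by simp only [ofHC_smul]; ext <;> simp <;> ring)
  smul_zero z := ofHC_inj (by simp only [ofHC_smul, ofHC_zero, zero_mul])
  smul_add z p q := ofHC_inj (by simp only [ofHC_smul, ofHC_add, add_mul])
  add_smul z w q := ofHC_inj (by simp only [ofHC_smul, ofHC_add]; ext <;> simp <;> ring)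
  zero_smul q := ofHC_inj (by
    have h : c2q 0 = 0 := rfl
    rw [ofHC_smul, ofHC_zero, h, mul_zero])

instance : InnerProductSpace ℂ HC where
  norm_smul_le z q := by
    rw [← norm_ofHC, ofHC_smul, norm_mul, norm_c2q, norm_ofHC, mul_comm]
  norm_sq_eq_re_inner x := by
    rw [← norm_ofHC, sq, ← Quaternion.normSq_eq_norm_mul_self, Quaternion.normSq_def']
    simp [inner]; ring
  conj_inner_symm x y := by
    apply Complex.ext <;> simp [inner] <;> ring
  add_left x y z := by
    apply Complex.ext <;> simp [inner, ofHC_add] <;> ring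
  smul_left x y r := by
    apply Complex.ext <;> simp [inner, ofHC_smul] <;> ring

/-- The real linear identification. -/
def eHC : HC →ₗᵢ[ℝ] Hq where
  toFun := ofHC
  map_add' := ofHC_add
  map_smul' := fun r q => by
    have : r • q = (r : ℂ) • q := rfl
    rw [this, ofHC_smul]; ext <;> simp <;> ring
  norm_map' := norm_ofHC

lemma mix_norm {X : Type*} [NormedAddCommGroup X] [InnerProductSpace ℝ X]
    (ρ K : X →ₗᵢ[ℝ] X) (hρ : ∀ x, ρ (ρ x) = x) (hc : ∀ x, ρ (K x) = K (ρ x)) (x : X) :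
    ‖(1 / 2 : ℝ) • ((x + ρ x) + K (ρ x - x))‖ = ‖x‖ := by
  have h0 : inner ℝ (x + ρ x) (K (ρ x - x)) = 0 := by
    have h1 := ρ.inner_map_map (x + ρ x) (K (ρ x - x))
    rw [hc, map_add, map_sub, hρ, add_comm (ρ x) x, ← neg_sub (ρ x) x, map_neg, inner_neg_right] at h1
    linarith
  have h2 := norm_add_sq_real (x + ρ x) (K (ρ x - x))
  rw [h0, K.norm_map] at h2
  have h3 := parallelogram_law_with_norm ℝ x (ρ x)
  rw [ρ.norm_map, norm_sub_rev] at h3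
  rw [norm_smul]
  have h4 : ‖(1/2 : ℝ)‖ = 1/2 := by norm_num
  rw [h4]
  have h5 : ‖x + ρ x + K (ρ x - x)‖ ^ 2 = (2 * ‖x‖) ^ 2 := by rw [h2]; linarith
  have h6 := (sq_eq_sq₀ (norm_nonneg _) (by positivity)).1 h5
  rw [h6]; ring

lemma mix_surj {X : Type*} [NormedAddCommGroup X] [InnerProductSpace ℝ X]
    (ρ K : X →ₗᵢ[ℝ] X) (hρ : ∀ x, ρ (ρ x) = x) (hc : ∀ x, ρ (K x) = K (ρ x))
    (hK : ∀ x, K (K x) = -x) :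
    Function.Surjective fun x => (1 / 2 : ℝ) • ((x + ρ x) + K (ρ x - x)) := by
  intro y
  refine ⟨(1 / 2 : ℝ) • ((y + ρ y) - K (ρ y - y)), ?_⟩
  simp only [map_smul, map_add, map_sub, hc, hρ, hK]
  module

abbrev L2 := Lp Hq 2 (volume : Measure (ℝ × ℝ))

/-- Right multiplication by `k` on `L²`. -/
def rK : L2 →ₗᵢ[ℝ] L2 where
  toLinearMap := ((ContinuousLinearMap.mul ℝ Hq).flip qk).compLpₗ 2 volume
  norm_map' g := by
    have h : ∀ᵐ x, ‖((((ContinuousLinearMap.mul ℝ Hq).flip qk).compLpₗ 2 volume g : L2) : ℝ × ℝ → Hq) x‖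
        = ‖(g : ℝ × ℝ → Hq) x‖ := by
      have h1 : (((((ContinuousLinearMap.mul ℝ Hq).flip qk).compLpₗ 2 volume g : L2) : ℝ × ℝ → Hq))
        =ᵐ[volume] _ := ((ContinuousLinearMap.mul ℝ Hq).flip qk).coeFn_compLp g
      have hk : ‖qk‖ = 1 := by
        have : ‖qk‖ * ‖qk‖ = 1 := by
          rw [← Quaternion.normSq_eq_norm_mul_self, Quaternion.normSq_def']; simp [qk]
        nlinarith [norm_nonneg qk]
      filter_upwards [h1] with x hx
      rw [hx]; simp [hk]
    exact le_antisymm (Lp.norm_le_norm_of_ae_le (h.mono fun x hx => hx.le))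
      (Lp.norm_le_norm_of_ae_le (h.mono fun x hx => hx.ge))

lemma rK_coe (g : L2) : (rK g : ℝ × ℝ → Hq) =ᵐ[volume] fun x => g x * qk :=
  ((ContinuousLinearMap.mul ℝ Hq).flip qk).coeFn_compLp g

def Rf (x : ℝ × ℝ) : ℝ × ℝ := (x.1, -x.2)

lemma Rf_mp : MeasurePreserving Rf (volume : Measure (ℝ × ℝ)) volume := by
  exact (MeasurePreserving.id volume).prod (Measure.measurePreserving_neg (volume : Measure ℝ))

def rR : L2 →ₗᵢ[ℝ] L2 := Lp.compMeasurePreservingₗᵢ ℝ Rf Rf_mp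

lemma rR_coe (g : L2) : (rR g : ℝ × ℝ → Hq) =ᵐ[volume] fun x => g (Rf x) :=
  Lp.coeFn_compMeasurePreserving g Rf_mp

lemma rR_rR (g : L2) : rR (rR g) = g := by
  apply Lp.ext
  filter_upwards [rR_coe (rR g), Rf_mp.quasiMeasurePreserving.ae (rR_coe g)] with x h1 h2
  rw [h1, h2]; simp [Rf]

lemma rR_rK (g : L2) : rR (rK g) = rK (rR g) := by
  apply Lp.ext
  filter_upwards [rR_coe (rK g), Rf_mp.quasiMeasurePreserving.ae (rK_coe g), rR_coe g, rK_coe (rR g)]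
    with x h1 h2 h3 h4
  rw [h1, h2, h4, h3]

lemma rK_rK (g : L2) : rK (rK g) = -g := by
  apply Lp.ext
  filter_upwards [rK_coe (rK g), rK_coe g, Lp.coeFn_neg g] with x h1 h2 h3
  rw [h1, h2, h3]
  have : qk * qk = -1 := by ext <;> simp
  rw [mul_assoc, this]; simp

def opU (g : L2) : L2 := (1 / 2 : ℝ) • ((g + rR g) + rK (rR g - g))

lemma opU_norm (g : L2) : ‖opU g‖ = ‖g‖ := mix_norm rR rK rR_rR rR_rK g
lemma opU_surj : Function.Surjective opU := mix_surj rR rK rR_rR rR_rK rK_rK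
lemma opU_add (f g : L2) : opU (f + g) = opU f + opU g := by
  simp only [opU, map_add, map_sub]; module

lemma opU_coe (g : L2) : (opU g : ℝ × ℝ → Hq) =ᵐ[volume]
    fun x => (1 / 2 : ℝ) • ((g x + g (Rf x)) + (g (Rf x) - g x) * qk) := by
  filter_upwards [Lp.coeFn_smul (1 / 2 : ℝ) ((g + rR g) + rK (rR g - g)),
    Lp.coeFn_add (g + rR g) (rK (rR g - g)), Lp.coeFn_add g (rR g), rK_coe (rR g - g),
    Lp.coeFn_sub (rR g) g, rR_coe g] with x h1 h2 h3 h4 h5 h6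
  rw [opU, h1, Pi.smul_apply, h2, Pi.add_apply, h3, Pi.add_apply, h4, h5, Pi.sub_apply, h6]

/-- dilation -/
lemma scale_eLpNorm {c : ℝ} (hc : c ≠ 0) {g : ℝ × ℝ → Hq} (hg : AEStronglyMeasurable g) :
    eLpNorm (fun x => c • g (c • x)) 2 volume = eLpNorm g 2 volume := by
  have h1 : Measure.map (c • ·) (volume : Measure (ℝ × ℝ)) = _ := Measure.map_addHaar_smul volume hc
  have h2 : eLpNorm (fun x => c • g (c • x)) 2 volume
      = ‖c‖ₑ * eLpNorm (g ∘ (c • ·)) 2 volume := eLpNorm_const_smul c (g ∘ (c • ·)) 2 volume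
  rw [h2, ← eLpNorm_map_measure _ (by fun_prop), h1, eLpNorm_smul_measure_of_ne_top (by simp)]
  · rw [smul_eq_mul, ← mul_assoc]
    have : ‖c‖ₑ * ENNReal.ofReal |(c ^ Module.finrank ℝ (ℝ × ℝ))⁻¹| ^ (1 / (2:ℝ≥0∞)).toReal = 1 := by
      have h3 : |(c ^ Module.finrank ℝ (ℝ × ℝ))⁻¹| = |c|⁻¹ ^ (2:ℝ) := by
        simp
      rw [h3, ← ENNReal.ofReal_rpow_of_nonneg (by positivity) (by norm_num), ← ENNReal.rpow_mul]
      rw [Real.enorm_eq_ofReal_abs]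
      simp only [one_div, ENNReal.toReal_inv, ENNReal.toReal_ofNat]
      rw [mul_inv_cancel₀ (by norm_num), ENNReal.rpow_one, ← ENNReal.ofReal_mul (by positivity),
        mul_inv_cancel₀ (by positivity), ENNReal.ofReal_one]
    rw [this, one_mul]
  · rw [h1]; exact hg.mono_ac Measure.smul_absolutelyContinuous

lemma scale_qmp {c : ℝ} (hc : c ≠ 0) :
    Measure.QuasiMeasurePreserving (fun x : ℝ × ℝ => c • x) volume volume :=
  ⟨by fun_prop, by rw [Measure.map_addHaar_smul volume hc]; exact Measure.smul_absolutelyContinuous⟩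

lemma scale_memLp {c : ℝ} (hc : c ≠ 0) (g : L2) : MemLp (fun x => c • g (c • x)) 2 volume :=
  ⟨((Lp.aestronglyMeasurable g).comp_quasiMeasurePreserving (scale_qmp hc)).const_smul c, by
    rw [scale_eLpNorm hc (Lp.aestronglyMeasurable g)]; exact Lp.eLpNorm_lt_top g⟩

def opS {c : ℝ} (hc : c ≠ 0) (g : L2) : L2 := (scale_memLp hc g).toLp _

lemma opS_coe {c : ℝ} (hc : c ≠ 0) (g : L2) :
    (opS hc g : ℝ × ℝ → Hq) =ᵐ[volume] fun x => c • g (c • x) := MemLp.coeFn_toLp _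

lemma opS_norm {c : ℝ} (hc : c ≠ 0) (g : L2) : ‖opS hc g‖ = ‖g‖ := by
  rw [opS, Lp.norm_toLp, scale_eLpNorm hc (Lp.aestronglyMeasurable g), Lp.norm_def]

lemma opS_add {c : ℝ} (hc : c ≠ 0) (f g : L2) : opS hc (f + g) = opS hc f + opS hc g := by
  apply Lp.ext
  filter_upwards [opS_coe hc (f + g), Lp.coeFn_add (opS hc f) (opS hc g), opS_coe hc f, opS_coe hc g,
    (scale_qmp hc).ae (Lp.coeFn_add f g)] with x h1 h2 h3 h4 h5
  rw [h1, h2, Pi.add_apply, h3, h4, h5, Pi.add_apply, smul_add]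

lemma opS_surj {c : ℝ} (hc : c ≠ 0) : Function.Surjective (opS hc) := by
  intro g
  refine ⟨opS (inv_ne_zero hc) g, ?_⟩
  apply Lp.ext
  filter_upwards [opS_coe hc (opS (inv_ne_zero hc) g),
    (scale_qmp hc).ae (opS_coe (inv_ne_zero hc) g)] with x h1 h2
  rw [h1, h2, smul_smul, smul_smul, mul_inv_cancel₀ hc, inv_mul_cancel₀ hc, one_smul, one_smul]

abbrev E2 := WithLp 2 (ℝ × ℝ)

lemma mp_ofLp : MeasurePreserving (fun v : E2 => v.ofLp) volume volume :=
  WithLp.volume_preserving_ofLp ℝ ℝ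
lemma mp_toLp : MeasurePreserving (fun v : ℝ × ℝ => (WithLp.toLp 2 v : E2)) volume volume :=
  WithLp.volume_preserving_toLp ℝ ℝ

def castHC {α : Type*} [MeasureSpace α] (f : Lp Hq 2 (volume : Measure α)) :
    Lp HC 2 (volume : Measure α) := f
def castHq {α : Type*} [MeasureSpace α] (f : Lp HC 2 (volume : Measure α)) :
    Lp Hq 2 (volume : Measure α) := f

def opT (f : L2) : L2 :=
  castHq (Lp.compMeasurePreserving _ mp_toLp
    (Lp.fourierTransformₗᵢ E2 HC (castHC (Lp.compMeasurePreserving _ mp_ofLp f))))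

lemma opT_norm (f : L2) : ‖opT f‖ = ‖f‖ := by
  have h := (Lp.norm_compMeasurePreserving (Lp.fourierTransformₗᵢ E2 HC
    (castHC (Lp.compMeasurePreserving _ mp_ofLp f))) mp_toLp)
  rw [LinearIsometryEquiv.norm_map] at h
  exact h.trans (Lp.norm_compMeasurePreserving f mp_ofLp)

lemma opT_add (f g : L2) : opT (f + g) = opT f + opT g := by
  unfold opT
  rw [map_add]
  have h1 : ∀ u v : Lp Hq 2 (volume : Measure E2), castHC (u + v) = castHC u + castHC v :=
    fun u v => rfl
  rw [h1, map_add, map_add]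
  rfl

lemma opT_surj : Function.Surjective opT := by
  intro g
  refine ⟨Lp.compMeasurePreserving _ mp_toLp (castHq ((Lp.fourierTransformₗᵢ E2 HC).symm
    (Lp.compMeasurePreserving _ mp_ofLp (castHC g)))), ?_⟩
  unfold opT
  rw [← Lp.compMeasurePreserving_comp_apply]
  have e1 : ∀ u : Lp Hq 2 (volume : Measure E2),
      Lp.compMeasurePreserving _ (mp_toLp.comp mp_ofLp) u = u := fun u =>
    Lp.compMeasurePreserving_id_apply u
  have e2 : ∀ u : Lp HC 2 (volume : Measure (ℝ × ℝ)),
      Lp.compMeasurePreserving _ (mp_ofLp.comp mp_toLp) u = u := fun u =>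
    Lp.compMeasurePreserving_id_apply u
  rw [e1]
  have e3 : ∀ u : Lp HC 2 (volume : Measure E2), castHC (castHq u) = u := fun u => rfl
  rw [e3, LinearIsometryEquiv.apply_symm_apply, ← Lp.compMeasurePreserving_comp_apply, e2]
  rfl

lemma c2q_exp (θ : ℝ) : c2q (Real.fourierChar θ : ℂ) = qexp qi (2 * π * θ) := by
  rw [Real.fourierChar_apply]
  ext <;> simp [qexp, Complex.exp_ofReal_mul_I_re, Complex.exp_ofReal_mul_I_im, -Complex.ofReal_mul]

lemma opT_coe (f : L2) (hf : Integrable (f : ℝ × ℝ → Hq)) : (opT f : ℝ × ℝ → Hq) =ᵐ[volume]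
    fun ω => ∫ x : ℝ × ℝ, f x * qexp qi (-(2 * π * (ω.1 * x.1 + ω.2 * x.2))) := by
  set f1 : Lp Hq 2 (volume : Measure E2) := Lp.compMeasurePreserving _ mp_ofLp f with hf1
  have h1 : (f1 : E2 → Hq) =ᵐ[volume] fun v => f v.ofLp := Lp.coeFn_compMeasurePreserving f mp_ofLp
  have hint : Integrable (f1 : E2 → Hq) := (mp_ofLp.integrable_comp_of_integrable hf).congr h1.symm
  have h2 := fourier_L1L2 (castHC f1) hint
  have h3 := Lp.coeFn_compMeasurePreserving (Lp.fourierTransformₗᵢ E2 HC (castHC f1)) mp_toLp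
  filter_upwards [h3, mp_toLp.quasiMeasurePreserving.ae h2] with ω h4 h5
  have h6 : (opT f : ℝ × ℝ → Hq) ω = eHC (((Lp.compMeasurePreserving _ mp_toLp
    (Lp.fourierTransformₗᵢ E2 HC (castHC f1)) : Lp HC 2 (volume : Measure (ℝ × ℝ))) : ℝ × ℝ → HC) ω) := rfl
  rw [h6, h4, Function.comp_apply, h5, Real.fourier_eq]
  rw [← LinearIsometry.integral_comp_comm]
  have h7 := mp_ofLp.integral_comp' (f := (MeasurableEquiv.toLp 2 (ℝ × ℝ)).symm)
   (g := fun x : ℝ × ℝ => f x * qexp qi (-(2 * π * (ω.1 * x.1 + ω.2 * x.2))))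
  rw [← h7]
  apply integral_congr_ae
  filter_upwards [h1] with v hv
  have h8 : eHC ((Real.fourierChar (-inner ℝ v (WithLp.toLp 2 ω))) • (castHC f1 : E2 → HC) v)
    = (f1 : E2 → Hq) v * c2q (Real.fourierChar (-inner ℝ v (WithLp.toLp 2 ω)) : ℂ) := rfl
  rw [h8, hv, c2q_exp]
  simp [WithLp.prod_inner_apply]
  left
  congr 1
  ring

lemma qexp_prod (a b : ℝ) : qexp qi (-a) * qexp qj (-b) =
    (1 / 2 : ℝ) • ((qexp qi (-(a + b)) + qexp qi (-(a - b)))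
      + (qexp qi (-(a - b)) - qexp qi (-(a + b))) * qk) := by
  ext <;> simp [qexp, Real.cos_add, Real.sin_add, Real.cos_sub, Real.sin_sub] <;> ring

lemma norm_qexp_qi (θ : ℝ) : ‖qexp qi θ‖ = 1 := by
  have : ‖qexp qi θ‖ * ‖qexp qi θ‖ = 1 := by
    rw [← Quaternion.normSq_eq_norm_mul_self, Quaternion.normSq_def']; simp [qexp]
  nlinarith [norm_nonneg (qexp qi θ)]

lemma int_exp {f : ℝ × ℝ → Hq} (hf : Integrable f) (a b : ℝ) :
    Integrable fun x : ℝ × ℝ => f x * qexp qi (-(a * x.1 + b * x.2)) := by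
  refine hf.norm.mono' (hf.aestronglyMeasurable.mul ?_) ?_
  · apply Continuous.aestronglyMeasurable
    unfold qexp
    fun_prop
  · filter_upwards with x
    rw [norm_mul, norm_qexp_qi, mul_one]

lemma Fr_eq {f : ℝ × ℝ → Hq} (hf : Integrable f) (ω : ℝ × ℝ) :
    Fr f ω = (1 / 2 : ℝ) •
      (((1 / (2 * π)) • ∫ x : ℝ × ℝ, f x * qexp qi (-(ω.1 * x.1 + ω.2 * x.2)))
      + ((1 / (2 * π)) • ∫ x : ℝ × ℝ, f x * qexp qi (-(ω.1 * x.1 + (-ω.2) * x.2)))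
      + (((1 / (2 * π)) • ∫ x : ℝ × ℝ, f x * qexp qi (-(ω.1 * x.1 + (-ω.2) * x.2)))
        - ((1 / (2 * π)) • ∫ x : ℝ × ℝ, f x * qexp qi (-(ω.1 * x.1 + ω.2 * x.2)))) * qk) := by
  have i1 := int_exp hf ω.1 ω.2
  have i2 := int_exp hf ω.1 (-ω.2)
  have e : ∀ x : ℝ × ℝ, f x * qexp qi (-(ω.1 * x.1)) * qexp qj (-(ω.2 * x.2)) =
      (1 / 2 : ℝ) • ((f x * qexp qi (-(ω.1 * x.1 + ω.2 * x.2))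
        + f x * qexp qi (-(ω.1 * x.1 + (-ω.2) * x.2)))
        + (ContinuousLinearMap.mul ℝ Hq).flip qk (f x * qexp qi (-(ω.1 * x.1 + (-ω.2) * x.2))
          - f x * qexp qi (-(ω.1 * x.1 + ω.2 * x.2)))) := by
    intro x
    rw [mul_assoc, qexp_prod, neg_mul, ← sub_eq_add_neg]
    simp only [ContinuousLinearMap.flip_apply, ContinuousLinearMap.mul_apply', mul_smul_comm,
      mul_add, mul_sub, sub_mul, mul_assoc]
  unfold Fr
  simp_rw [e]
  have main : ∀ u v : ℝ × ℝ → Hq, Integrable u → Integrable v →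
      ∫ x, (1 / 2 : ℝ) • ((u x + v x) + (ContinuousLinearMap.mul ℝ Hq).flip qk (v x - u x)) =
        (1 / 2 : ℝ) • ((∫ x, u x) + (∫ x, v x) + ((∫ x, v x) - ∫ x, u x) * qk) := by
    intro u v hu hv
    have i3 : Integrable fun x => u x + v x := hu.add hv
    have i4 : Integrable fun x => v x - u x := hv.sub hu
    rw [integral_smul, integral_add i3 (ContinuousLinearMap.integrable_comp _ i4),
      ContinuousLinearMap.integral_comp_comm _ i4, integral_add hu hv, integral_sub hv hu]
    rfl
  rw [main _ _ i1 i2]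
  simp only [sub_mul, smul_mul_assoc]
  module

lemma c_ne : (1 / (2 * π) : ℝ) ≠ 0 := by positivity

def opPsi (f : L2) : L2 := opU (opS c_ne (opT f))

lemma opPsi_norm (f : L2) : ‖opPsi f‖ = ‖f‖ := by
  rw [opPsi, opU_norm, opS_norm, opT_norm]
lemma opPsi_add (f g : L2) : opPsi (f + g) = opPsi f + opPsi g := by
  simp only [opPsi, opT_add, opS_add, opU_add]
lemma opPsi_surj : Function.Surjective opPsi :=
  opU_surj.comp ((opS_surj c_ne).comp opT_surj)

lemma opPsi_coe (f : L2) (hf : Integrable (f : ℝ × ℝ → Hq)) :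
    (opPsi f : ℝ × ℝ → Hq) =ᵐ[volume] Fr f := by
  have hS : (opS c_ne (opT f) : ℝ × ℝ → Hq) =ᵐ[volume] fun ω => (1 / (2 * π)) •
      ∫ x : ℝ × ℝ, f x * qexp qi (-(ω.1 * x.1 + ω.2 * x.2)) := by
    filter_upwards [opS_coe c_ne (opT f), (scale_qmp c_ne).ae (opT_coe f hf)] with ω h1 h2
    rw [h1, h2]
    congr 2
    ext1 x
    congr 3
    simp only [Prod.smul_fst, Prod.smul_snd, smul_eq_mul]
    field_simp
  filter_upwards [opU_coe (opS c_ne (opT f)), hS, Rf_mp.quasiMeasurePreserving.ae hS] with ω h1 h2 h3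
  rw [opPsi, h1, h2, h3, Fr_eq hf]
  rfl

lemma Fr_smul (q : Hq) {f : ℝ × ℝ → Hq} (hf : Integrable f) (ω : ℝ × ℝ) :
    Fr (fun x => q * f x) ω = q * Fr f ω := by
  have h : ∀ a b : ℝ, ∫ x : ℝ × ℝ, (q * f x) * qexp qi (-(a * x.1 + b * x.2))
      = q * ∫ x : ℝ × ℝ, f x * qexp qi (-(a * x.1 + b * x.2)) := by
    intro a b
    simp_rw [mul_assoc]
    exact ContinuousLinearMap.integral_comp_comm (ContinuousLinearMap.mul ℝ Hq q) (int_exp hf a b)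
  rw [Fr_eq hf, Fr_eq (hf.const_mul q)]
  simp only [h]
  simp only [mul_smul_comm, mul_add, mul_sub, sub_mul, mul_assoc, smul_mul_assoc]

lemma Fr_congr {f g : ℝ × ℝ → Hq} (h : f =ᵐ[volume] g) : Fr f = Fr g := by
  ext1 ω
  unfold Fr
  congr 1
  apply integral_congr_ae
  filter_upwards [h] with x hx
  rw [hx]

lemma opPsi_smul (q : Hq) (f : L2) : opPsi (q • f) = q • opPsi f := by
  have hcont : Continuous opPsi := by
    have : Isometry (AddMonoidHom.mk' opPsi opPsi_add) :=
      AddMonoidHomClass.isometry_of_norm _ opPsi_norm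
    exact this.continuous
  refine Lp.induction (by simp) (fun f : L2 => opPsi (q • f) = q • opPsi f) ?_ ?_ ?_ f
  · intro c s hs hμ
    set f : L2 := (Lp.simpleFunc.indicatorConst 2 hs hμ.ne c).1 with hfd
    have hf : Integrable (f : ℝ × ℝ → Hq) := by
      have h1 : (f : ℝ × ℝ → Hq) =ᵐ[volume] s.indicator fun _ => c := by
        rw [hfd, Lp.simpleFunc.coe_indicatorConst]
        exact indicatorConstLp_coeFn
      exact ((integrable_indicator_iff hs).2 (integrableOn_const hμ.ne)).congr h1.symm
    have hq : ((q • f : L2) : ℝ × ℝ → Hq) =ᵐ[volume] fun x => q * f x := Lp.coeFn_smul q f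
    apply Lp.ext
    filter_upwards [opPsi_coe (q • f) ((hf.const_mul q).congr hq.symm), opPsi_coe f hf,
      Lp.coeFn_smul q (opPsi f)] with ω h1 h2 h3
    rw [h1, h3, Pi.smul_apply, h2, Fr_congr hq, Fr_smul q hf, smul_eq_mul]
  · intro f g hf hg _ h1 h2
    rw [smul_add, opPsi_add, opPsi_add, h1, h2, smul_add]
  · exact isClosed_eq (hcont.comp (continuous_const_smul q)) (hcont.const_smul q)

theorem stmt7 :
    ∃ Ψ : Lp Hq 2 (volume : Measure (ℝ × ℝ)) → Lp Hq 2 (volume : Measure (ℝ × ℝ)),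
      (∀ (q : Hq) (f g : Lp Hq 2 (volume : Measure (ℝ × ℝ))),
        Ψ (q • f + g) = q • Ψ f + Ψ g) ∧
      (∀ f : Lp Hq 2 (volume : Measure (ℝ × ℝ)), ‖Ψ f‖ = ‖f‖) ∧
      Function.Surjective Ψ ∧
      (∀ f : Lp Hq 2 (volume : Measure (ℝ × ℝ)),
        Integrable (f : ℝ × ℝ → Hq) → (Ψ f : ℝ × ℝ → Hq) =ᵐ[volume] Fr f) := by
  refine ⟨opPsi, fun q f g => ?_, opPsi_norm, opPsi_surj, opPsi_coe⟩
  rw [opPsi_add, opPsi_smul]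
end
end
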